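/- arXiv:2212.00870 — 2 statements merged into one kernel-verified Lean document; each statement's English description precedes it below -/
import Mathlib

section
/- Fix a prime power q and integers s > r ≥ 1. There exist a positive integer k depending only on s, and two nonempty sets Υ and Υ' of s-dimensional F_q-subspaces of F_q^k, such that: (1) for distinct P, P' ∈ Υ one has dim(P ∩ P') < r, and likewise for distinct P, P' ∈ Υ'; (2) for every P ∈ Υ and P' ∈ Υ' one has dim(P ∩ P') ≤ r; (3) ∂_{s,r}Υ = ∂_{s,r}Υ', i.e., Σ_{P∈Υ} Σ_{R ≤ P, dim R = r} e_R = Σ_{P∈Υ'} Σ_{R ≤ P, dim R = r} e_R as vectors in Z^{Gr_q(k,r)}. -/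
open scoped Classical

noncomputable section

section LinearizedPolynomials

variable (F K : Type*) [Field F] [Fintype F] [Field K] [Algebra F K]

/-- The `F`-linear map `x ↦ ∑ i, a i * x ^ (q ^ i)`, where `q = |F|`. -/
def linearizedMap (n : ℕ) : (Fin n → K) →ₗ[K] (K →ₗ[F] K) :=
  Fintype.linearCombination K fun i : Fin n =>
    (FiniteField.frobeniusAlgHom F K ^ (i : ℕ)).toLinearMap

variable {F K}

theorem linearizedMap_apply {n : ℕ} (a : Fin n → K) (x : K) :
    linearizedMap F K n a x = ∑ i, a i * x ^ Fintype.card F ^ (i : ℕ) := by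
  simp [linearizedMap, Fintype.linearCombination_apply, AlgHom.coe_pow,
    FiniteField.coe_frobeniusAlgHom, pow_iterate]

/-- A nonzero linearized polynomial of `q`-degree less than `n` has kernel of dimension less than
`n`. -/
theorem finrank_ker_linearizedMap_lt [Finite K] {n : ℕ} {a : Fin n → K} (ha : a ≠ 0) :
    Module.finrank F (LinearMap.ker (linearizedMap F K n a)) < n := by
  have := Fintype.ofFinite K
  have hq : 1 < Fintype.card F := Fintype.one_lt_card
  set p : Polynomial K :=
    ∑ i : Fin n, Polynomial.C (a i) * Polynomial.X ^ Fintype.card F ^ (i : ℕ) with hp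
  obtain ⟨i, hi⟩ := Function.ne_iff.mp ha
  have hcoeff : p.coeff (Fintype.card F ^ (i : ℕ)) = a i := by
    rw [hp, Polynomial.finsetSum_coeff, Finset.sum_eq_single i]
    · simp
    · intro j _ hj
      rw [Polynomial.coeff_C_mul_X_pow, if_neg]
      exact fun h => hj (Fin.ext (Nat.pow_right_injective hq h).symm)
    · simp
  have hp0 : p ≠ 0 := fun h => hi (by rw [← hcoeff, h]; simp)
  have hdeg : p.natDegree < Fintype.card F ^ n := by
    rw [Polynomial.natDegree_lt_iff_degree_lt hp0]
    refine (Polynomial.degree_sum_le _ _).trans_lt ?_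
    rw [Finset.sup_lt_iff (WithBot.bot_lt_coe _)]
    intro j _
    refine (Polynomial.degree_C_mul_X_pow_le _ _).trans_lt ?_
    exact_mod_cast Nat.pow_lt_pow_right hq j.isLt
  have hcard : Fintype.card (LinearMap.ker (linearizedMap F K n a)) ≤ p.natDegree := by
    refine (Set.toFinset_card (LinearMap.ker (linearizedMap F K n a) : Set K)).symm.trans_le ?_
    refine Polynomial.card_le_degree_of_subset_roots fun x hx => ?_
    have hx' : linearizedMap F K n a x = 0 := by simpa using hx
    rw [linearizedMap_apply] at hx'
    rw [Polynomial.mem_roots hp0]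
    simpa [hp, Polynomial.eval_finsetSum] using hx'
  rw [Module.card_eq_pow_finrank (K := F)] at hcard
  exact (Nat.pow_lt_pow_iff_right hq).mp (hcard.trans_lt hdeg)

/-- The difference of a linearized polynomial of `q`-degree less than `r` and one that is monic of
`q`-degree `r` has kernel of dimension at most `r`. -/
theorem finrank_ker_linearizedMap_sub_monic_le [Finite K] {r : ℕ} (a b : Fin r → K) :
    Module.finrank F (LinearMap.ker (linearizedMap F K r a -
      (linearizedMap F K r b + (FiniteField.frobeniusAlgHom F K ^ r).toLinearMap))) ≤ r := by
  have h : linearizedMap F K r a -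
      (linearizedMap F K r b + (FiniteField.frobeniusAlgHom F K ^ r).toLinearMap) =
      linearizedMap F K (r + 1) (Fin.snoc (a - b) (-1)) := by
    rw [← sub_sub, ← map_sub]
    simp [linearizedMap, Fintype.linearCombination_apply, Fin.sum_univ_castSucc, sub_eq_add_neg]
  rw [h, ← Nat.lt_succ_iff]
  refine finrank_ker_linearizedMap_lt fun h0 => ?_
  simpa using congrFun h0 (Fin.last r)

/-- Interpolation: on the injective image of an `r`-dimensional space, every `F`-linear map is given
by a linearized polynomial of `q`-degree less than `r`. -/
theorem exists_linearizedMap_comp_eq [Finite K] {R : Type*} [AddCommGroup R] [Module F R]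
    [FiniteDimensional F R] (ι : R →ₗ[F] K) (hι : Function.Injective ι) (g : R →ₗ[F] K) :
    ∃ a, linearizedMap F K (Module.finrank F R) a ∘ₗ ι = g := by
  let Φ : (Fin (Module.finrank F R) → K) →ₗ[K] (R →ₗ[F] K) :=
    { toFun := fun a => linearizedMap F K _ a ∘ₗ ι
      map_add' := fun a b => by rw [map_add, LinearMap.add_comp]
      map_smul' := fun c a => by rw [map_smul, LinearMap.smul_comp, RingHom.id_apply] }
  have hdim : Module.finrank K (Fin (Module.finrank F R) → K) =
      Module.finrank K (R →ₗ[F] K) := by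
    rw [Module.finrank_linearMap_self, Module.finrank_fin_fun]
  have hinj : Function.Injective Φ := by
    rw [injective_iff_map_eq_zero]
    intro a ha
    by_contra h0
    refine (finrank_ker_linearizedMap_lt (F := F) h0).not_ge ?_
    refine (LinearMap.finrank_range_of_inj hι).symm.trans_le ?_
    refine Submodule.finrank_mono ?_
    rintro _ ⟨x, rfl⟩
    exact LinearMap.congr_fun ha x
  exact (LinearMap.injective_iff_surjective_of_finrank_eq_finrank hdim).mp hinj g

end LinearizedPolynomials

section Graphs

variable {F K V : Type*} [Field F] [Field K] [Algebra F K] [AddCommGroup V] [Module F V]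

/-- The graph of `f`, transported along a decomposition of `V` as `K × K`. -/
def graphIn (e : V ≃ₗ[F] K × K) (f : K →ₗ[F] K) : Submodule F V :=
  f.graph.comap (e : V →ₗ[F] K × K)

theorem mem_graphIn {e : V ≃ₗ[F] K × K} {f : K →ₗ[F] K} {v : V} :
    v ∈ graphIn e f ↔ (e v).2 = f (e v).1 := by
  simp [graphIn, LinearMap.mem_graph_iff]

theorem fst_injOn_graphIn (e : V ≃ₗ[F] K × K) (f : K →ₗ[F] K) :
    Set.InjOn (fun v => (e v).1) (graphIn e f) := by
  intro v hv w hw h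
  refine e.injective (Prod.ext h ?_)
  rw [mem_graphIn.mp hv, mem_graphIn.mp hw]
  exact congrArg f h

theorem finrank_graphIn (e : V ≃ₗ[F] K × K) (f : K →ₗ[F] K) :
    Module.finrank F (graphIn e f) = Module.finrank F K := by
  refine LinearEquiv.finrank_eq (LinearEquiv.ofBijective
    (LinearMap.fst F K K ∘ₗ e.toLinearMap ∘ₗ (graphIn e f).subtype) ⟨?_, ?_⟩)
  · intro v w h
    exact Subtype.ext (fst_injOn_graphIn e f v.2 w.2 h)
  · intro x
    exact ⟨⟨e.symm (x, f x), by simp [mem_graphIn]⟩, by simp⟩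

theorem finrank_graphIn_inf_le [FiniteDimensional F K] (e : V ≃ₗ[F] K × K) (f g : K →ₗ[F] K) :
    Module.finrank F (graphIn e f ⊓ graphIn e g : Submodule F V) ≤
      Module.finrank F (LinearMap.ker (f - g)) := by
  let φ : (graphIn e f ⊓ graphIn e g : Submodule F V) →ₗ[F] LinearMap.ker (f - g) :=
    LinearMap.codRestrict _
      (LinearMap.fst F K K ∘ₗ e.toLinearMap ∘ₗ (graphIn e f ⊓ graphIn e g).subtype) fun v => by
        have hf := mem_graphIn.mp v.2.1
        have hg := mem_graphIn.mp v.2.2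
        simp [← hf, ← hg]
  refine LinearMap.finrank_le_finrank_of_injective (f := φ) fun v w h => ?_
  exact Subtype.ext (fst_injOn_graphIn e f v.2.1 w.2.1 (congrArg Subtype.val h))

variable [Fintype F] [Finite K]

theorem finrank_graphIn_linearizedMap_inf_lt {r : ℕ} (e : V ≃ₗ[F] K × K) (h : K →ₗ[F] K)
    {a b : Fin r → K} (hab : a ≠ b) :
    Module.finrank F (graphIn e (linearizedMap F K r a + h) ⊓
      graphIn e (linearizedMap F K r b + h) : Submodule F V) < r := by
  refine (finrank_graphIn_inf_le e _ _).trans_lt ?_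
  rw [add_sub_add_right_eq_sub, ← map_sub]
  exact finrank_ker_linearizedMap_lt (sub_ne_zero.mpr hab)

/-- Every `r`-dimensional subspace projecting injectively to the first factor lies in exactly one
of the graphs of `linearizedMap F K r a + h`, and no other `r`-dimensional subspace lies in any. -/
theorem ncard_graphIn_linearizedMap [FiniteDimensional F V] (e : V ≃ₗ[F] K × K) (h : K →ₗ[F] K)
    (R : Submodule F V) :
    {P | P ∈ Set.range (fun a => graphIn e (linearizedMap F K (Module.finrank F R) a + h)) ∧
      R ≤ P}.ncard = if Set.InjOn (fun v => (e v).1) R then 1 else 0 := by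
  split_ifs with hR
  · let ι : R →ₗ[F] K := LinearMap.fst F K K ∘ₗ e.toLinearMap ∘ₗ R.subtype
    have hι : Function.Injective ι := fun v w hvw => Subtype.ext (hR v.2 w.2 hvw)
    obtain ⟨a, ha⟩ := exists_linearizedMap_comp_eq ι hι
      (LinearMap.snd F K K ∘ₗ e.toLinearMap ∘ₗ R.subtype - h ∘ₗ ι)
    have hRa : R ≤ graphIn e (linearizedMap F K (Module.finrank F R) a + h) := by
      intro v hv
      have hav : linearizedMap F K _ a (e v).1 = (e v).2 - h (e v).1 :=
        LinearMap.congr_fun ha ⟨v, hv⟩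
      rw [mem_graphIn, LinearMap.add_apply, hav, sub_add_cancel]
    rw [Set.ncard_eq_one]
    refine ⟨_, Set.eq_singleton_iff_unique_mem.mpr ⟨⟨⟨a, rfl⟩, hRa⟩, ?_⟩⟩
    rintro _ ⟨⟨b, rfl⟩, hRb⟩
    by_contra hne
    have hba : b ≠ a := fun hba => hne (by rw [hba])
    exact (finrank_graphIn_linearizedMap_inf_lt e h hba).not_ge
      (Submodule.finrank_mono (le_inf hRb hRa))
  · convert Set.ncard_empty (Submodule F V)
    rw [Set.eq_empty_iff_forall_notMem]
    rintro _ ⟨⟨a, rfl⟩, hRa⟩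
    exact hR ((fst_injOn_graphIn e _).mono hRa)

end Graphs

theorem exists_finite_extension_finrank_eq (F : Type) [Field F] [Finite F] {n : ℕ} (hn : n ≠ 0) :
    ∃ (K : Type) (_ : Field K) (_ : Algebra F K), Finite K ∧ Module.finrank F K = n := by
  have : NeZero n := ⟨hn⟩
  obtain ⟨p, hp⟩ := CharP.exists F
  have : Fact p.Prime := ⟨CharP.char_is_prime F p⟩
  exact ⟨FiniteField.Extension F p n, inferInstance, inferInstance, inferInstance,
    FiniteField.finrank_extension F p n⟩

/-- **Proposition 3.1 (subspace exchange)**: there is `k = k(s)` and two nonempty families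
`Υ, Υ'` of `s`-dimensional subspaces of `F_q^k` such that distinct members of the same family
meet in dimension `< r`, members of different families meet in dimension `≤ r`, and
`∂_{s,r}Υ = ∂_{s,r}Υ'`. -/
theorem subspace_exchange (s r : ℕ) (hr : 1 ≤ r) (hrs : r < s) :
    ∃ k : ℕ, ∀ (F : Type) [Field F] [Fintype F],
      ∃ Υ Υ' : Set (Submodule F (Fin k → F)),
        Υ.Nonempty ∧ Υ'.Nonempty ∧
        (∀ P ∈ Υ, Module.finrank F P = s) ∧
        (∀ P ∈ Υ', Module.finrank F P = s) ∧
        (∀ P ∈ Υ, ∀ P' ∈ Υ, P ≠ P' → Module.finrank F (P ⊓ P' : Submodule F (Fin k → F)) < r) ∧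
        (∀ P ∈ Υ', ∀ P' ∈ Υ', P ≠ P' →
          Module.finrank F (P ⊓ P' : Submodule F (Fin k → F)) < r) ∧
        (∀ P ∈ Υ, ∀ P' ∈ Υ',
          Module.finrank F (P ⊓ P' : Submodule F (Fin k → F)) ≤ r) ∧
        (∀ R : Submodule F (Fin k → F), Module.finrank F R = r →
          {P | P ∈ Υ ∧ R ≤ P}.ncard = {P | P ∈ Υ' ∧ R ≤ P}.ncard) := by
  refine ⟨s + s, fun F _ _ => ?_⟩
  obtain ⟨K, _, _, _, hK⟩ := exists_finite_extension_finrank_eq F (show s ≠ 0 by omega)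
  let e : (Fin (s + s) → F) ≃ₗ[F] K × K := LinearEquiv.ofFinrankEq _ _ (by simp [hK])
  let h : K →ₗ[F] K := (FiniteField.frobeniusAlgHom F K ^ r).toLinearMap
  let Υ (g : K →ₗ[F] K) : Set (Submodule F (Fin (s + s) → F)) :=
    Set.range fun a => graphIn e (linearizedMap F K r a + g)
  have hdim (g : K →ₗ[F] K) : ∀ P ∈ Υ g, Module.finrank F P = s := by
    rintro _ ⟨a, rfl⟩
    rw [finrank_graphIn, hK]
  have hinf (g : K →ₗ[F] K) : ∀ P ∈ Υ g, ∀ P' ∈ Υ g, P ≠ P' →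
      Module.finrank F (P ⊓ P' : Submodule F (Fin (s + s) → F)) < r := by
    rintro _ ⟨a, rfl⟩ _ ⟨b, rfl⟩ hne
    exact finrank_graphIn_linearizedMap_inf_lt e g fun hab => hne (by rw [hab])
  refine ⟨Υ 0, Υ h, Set.range_nonempty _, Set.range_nonempty _, hdim 0, hdim h, hinf 0, hinf h,
    ?_, ?_⟩
  · rintro _ ⟨a, rfl⟩ _ ⟨b, rfl⟩
    refine (finrank_graphIn_inf_le e (linearizedMap F K r a + 0) _).trans ?_
    rw [add_zero]
    exact finrank_ker_linearizedMap_sub_monic_le a b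
  · rintro R rfl
    exact (ncard_graphIn_linearizedMap e 0 R).trans (ncard_graphIn_linearizedMap e h R).symm
end
end

section
/- Fix a prime power q and integers s > r ≥ 1. There exist a constant C depending only on q and s and a positive integer Δ depending only on q, s and r such that for all sufficiently large n the following holds. If θ ≥ q^{−n/2} and J ∈ Z^{Gr_q(n,r)} has every coordinate divisible by Δ and J is θ-bounded, then there exists Φ ∈ Z^{Gr_q(n,s)} with ∂_{s,r}Φ = J such that both ∂_{s,r}Φ⁺ and ∂_{s,r}Φ⁻ are Cθ-bounded. -/
open scoped Classical

noncomputable section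

/-- The type of `k`-dimensional `F`-linear subspaces of `F^n`. -/
abbrev Gr (F : Type) [Field F] (n k : ℕ) : Type :=
  {W : Submodule F (Fin n → F) // Module.finrank F W = k}

/-- The Gaussian binomial coefficient `[n choose k]_q` where `q = #F`. -/
def gbinom (F : Type) [Field F] [Fintype F] (n k : ℕ) : ℕ :=
  Nat.card (Gr F n k)

/-- The boundary map `∂_{a,b} : ℤ^{Gr_q(n,a)} → ℤ^{Gr_q(n,b)}` sending `e_S` to the sum of
`e_R` over `b`-dimensional subspaces `R ≤ S`. -/
def bdry (F : Type) [Field F] (n a b : ℕ) (Φ : Gr F n a → ℤ) : Gr F n b → ℤ :=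
  fun R => ∑ᶠ S : Gr F n a, if R.1 ≤ S.1 then Φ S else 0

/-- The positive part `Φ⁺` of an integer vector. -/
def pPart {α : Type} (Φ : α → ℤ) : α → ℤ := fun x => max (Φ x) 0

/-- The negative part `Φ⁻` of an integer vector, so `Φ = Φ⁺ + Φ⁻`. -/
def nPart {α : Type} (Φ : α → ℤ) : α → ℤ := fun x => min (Φ x) 0

/-- `J ∈ ℤ^{Gr_q(n,r)}` is `θ`-bounded: `‖∂_{r,r−1}J^±‖_∞ ≤ θ·q^n`. -/
def IsBounded (F : Type) [Field F] [Fintype F] (n r : ℕ) (θ : ℝ)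
    (J : Gr F n r → ℤ) : Prop :=
  ∀ Q : Gr F n (r - 1),
    |((bdry F n r (r - 1) (pPart J) Q : ℤ) : ℝ)| ≤ θ * (Fintype.card F : ℝ) ^ n ∧
    |((bdry F n r (r - 1) (nPart J) Q : ℤ) : ℝ)| ≤ θ * (Fintype.card F : ℝ) ^ n

open Module

section Counting

variable {F : Type} [Field F] [Fintype F]

instance finite_linearMap {V W : Type*} [AddCommGroup V] [Module F V] [Finite V]
    [AddCommGroup W] [Module F W] [Finite W] : Finite (V →ₗ[F] W) :=
  DFunLike.finite _

instance fintype_linearMap {V W : Type*} [AddCommGroup V] [Module F V] [Finite V]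
    [AddCommGroup W] [Module F W] [Finite W] : Fintype (V →ₗ[F] W) :=
  Fintype.ofFinite _

lemma bdry_eq_sum (n a b : ℕ) (Φ : Gr F n a → ℤ) (R : Gr F n b) :
    bdry F n a b Φ R = ∑ S : Gr F n a, if R.1 ≤ S.1 then Φ S else 0 :=
  finsum_eq_sum_of_fintype _

lemma card_submodule_le {V : Type*} [AddCommGroup V] [Module F V] [Finite V] :
    Nat.card (Submodule F V) ≤ 2 ^ (Fintype.card F) ^ finrank F V := by
  have := Fintype.ofFinite V
  calc Nat.card (Submodule F V) ≤ Nat.card (Set V) :=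
        Nat.card_le_card_of_injective _ SetLike.coe_injective
    _ = 2 ^ (Fintype.card F) ^ finrank F V := by
        rw [Nat.card_eq_fintype_card, Fintype.card_set, Module.card_eq_pow_finrank (K := F)]

/-- The subspaces of dimension `s` between `T` and `B` are counted by a Gaussian binomial. -/
lemma card_between {n r s b : ℕ} {T B : Submodule F (Fin n → F)} (hT : finrank F T = r)
    (hB : finrank F B = b) (hTB : T ≤ B) (hrs : r ≤ s) :
    Nat.card {S : Gr F n s // T ≤ S.1 ∧ S.1 ≤ B} = gbinom F (b - r) (s - r) := by
  set T' : Submodule F B := T.comap B.subtype with hT'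
  have hmapT : T'.map B.subtype = T := by
    rw [hT', Submodule.map_comap_subtype, inf_eq_right.mpr hTB]
  have hfT : finrank F T' = r := by
    rw [← hT, ← hmapT, Submodule.finrank_map_subtype_eq]
  have hq : finrank F (B ⧸ T') = finrank F (Fin (b - r) → F) := by
    have := Submodule.finrank_quotient_add_finrank T'
    rw [Module.finrank_fin_fun]
    omega
  let e := LinearEquiv.ofFinrankEq _ _ hq
  let π : B →ₗ[F] (Fin (b - r) → F) := e.toLinearMap ∘ₗ T'.mkQ
  have hπ : Function.Surjective π := e.surjective.comp T'.mkQ_surjective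
  have hker : LinearMap.ker π = T' := by
    simp [π, LinearEquiv.ker_comp]
  have hfin : ∀ U : Submodule F (Fin (b - r) → F),
      finrank F (U.comap π) = finrank F U + r := by
    intro U
    let g := π.restrict (p := U.comap π) (q := U) (fun x hx => hx)
    have hg : Function.Surjective g := by
      rintro ⟨u, hu⟩
      obtain ⟨x, rfl⟩ := hπ u
      exact ⟨⟨x, hu⟩, rfl⟩
    have h1 := LinearMap.finrank_range_add_finrank_ker (K := F) (V := U.comap π) (V₂ := U) g
    rw [LinearMap.range_eq_top.mpr hg, finrank_top] at h1
    have h2 : finrank F (LinearMap.ker g) = r := by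
      rw [← Submodule.finrank_map_subtype_eq (U.comap π)]
      have : (LinearMap.ker g).map (U.comap π).subtype = T' := by
        rw [← hker]
        ext x
        simp only [Submodule.mem_map, LinearMap.mem_ker, Submodule.coe_subtype]
        constructor
        · rintro ⟨y, hy, rfl⟩
          exact congrArg Subtype.val hy
        · intro hx
          exact ⟨⟨x, by simp [hx]⟩, Subtype.ext hx, rfl⟩
      rw [this, hfT]
    omega
  symm
  refine Nat.card_eq_of_bijective (fun U : Gr F (b - r) (s - r) =>
    ⟨⟨(U.1.comap π).map B.subtype, ?_⟩, ?_, ?_⟩) ⟨?_, ?_⟩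
  · rw [Submodule.finrank_map_subtype_eq, hfin, U.2]
    omega
  · exact hmapT.ge.trans (Submodule.map_mono (hker.ge.trans (LinearMap.ker_le_comap _)))
  · exact Submodule.map_subtype_le _ _
  · intro U U' h
    have h1 := congrArg (fun z => z.1.1) h
    exact Subtype.ext (Submodule.comap_injective_of_surjective hπ
      (Submodule.map_injective_of_injective B.subtype_injective h1))
  · rintro ⟨⟨S, hS⟩, hTS, hSB⟩
    have hTS' : T' ≤ S.comap B.subtype := Submodule.comap_mono hTS
    have hc : ((S.comap B.subtype).map π).comap π = S.comap B.subtype := by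
      rw [Submodule.comap_map_eq, hker, sup_eq_left.mpr hTS']
    have hm : (S.comap B.subtype).map B.subtype = S := by
      rw [Submodule.map_comap_subtype, inf_eq_right.mpr hSB]
    refine ⟨⟨(S.comap B.subtype).map π, ?_⟩, ?_⟩
    · have h1 := hfin ((S.comap B.subtype).map π)
      rw [hc, ← Submodule.finrank_map_subtype_eq, hm, hS] at h1
      omega
    · apply Subtype.ext
      apply Subtype.ext
      show (((S.comap B.subtype).map π).comap π).map B.subtype = S
      rw [hc, hm]

lemma gbinom_pos {n k : ℕ} (h : k ≤ n) : 0 < gbinom F n k := by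
  obtain ⟨f, hf⟩ := exists_linearIndependent_of_le_finrank (R := F) (M := Fin n → F) (n := k)
    (by simpa using h)
  have : Nonempty (Gr F n k) := ⟨⟨Submodule.span F (Set.range f), by
    simpa using finrank_span_eq_card hf⟩⟩
  exact Nat.card_pos

lemma gbinom_le (n k : ℕ) : gbinom F n k ≤ 2 ^ (Fintype.card F) ^ n := by
  refine (Nat.card_le_card_of_injective _ Subtype.val_injective).trans ?_
  simpa using card_submodule_le (F := F) (V := Fin n → F)

/-- The number of linear maps vanishing on a given subspace. -/
lemma card_linearMap_vanishing {V W : Type*} [AddCommGroup V] [Module F V] [Finite V]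
    [AddCommGroup W] [Module F W] [Finite W] (A : Submodule F V) :
    Nat.card {f : V →ₗ[F] W // A ≤ LinearMap.ker f} =
      Fintype.card F ^ ((finrank F V - finrank F A) * finrank F W) := by
  have h1 : Nat.card {f : V →ₗ[F] W // A ≤ LinearMap.ker f} = Nat.card ((V ⧸ A) →ₗ[F] W) := by
    symm
    refine Nat.card_eq_of_bijective (fun g => ⟨g ∘ₗ A.mkQ, ?_⟩) ⟨?_, ?_⟩
    · intro x hx
      simp [(Submodule.Quotient.mk_eq_zero A).mpr hx]
    · intro g g' h
      have h2 := congrArg Subtype.val h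
      exact LinearMap.ext fun x => by
        obtain ⟨y, rfl⟩ := A.mkQ_surjective x
        exact LinearMap.congr_fun h2 y
    · rintro ⟨f, hf⟩
      exact ⟨A.liftQ f hf, Subtype.ext (A.liftQ_mkQ f hf)⟩
  have : Finite (V ⧸ A) := Finite.of_surjective _ A.mkQ_surjective
  rw [h1, Nat.card_eq_fintype_card, Module.card_eq_pow_finrank (K := F), Module.finrank_linearMap]
  congr 2
  have := Submodule.finrank_quotient_add_finrank A
  omega

end Counting

section Decoder

lemma le_map_subtype_iff {F V : Type*} [Field F] [AddCommGroup V] [Module F V]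
    {W T : Submodule F V}
    {K : Submodule F W} : T ≤ K.map W.subtype ↔ T ≤ W ∧ T.comap W.subtype ≤ K := by
  constructor
  · intro h
    refine ⟨h.trans (Submodule.map_subtype_le _ _), ?_⟩
    rw [← Submodule.comap_map_eq_of_injective W.subtype_injective K]
    exact Submodule.comap_mono h
  · rintro ⟨h1, h2⟩
    have h3 := Submodule.map_mono (f := W.subtype) h2
    rwa [Submodule.map_comap_subtype, inf_eq_right.mpr h1] at h3

lemma finrank_comap_subtype {F V : Type*} [Field F] [AddCommGroup V] [Module F V]
    {W T : Submodule F V}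
    (h : T ≤ W) : finrank F (T.comap W.subtype) = finrank F T := by
  rw [← Submodule.finrank_map_subtype_eq, Submodule.map_comap_subtype, inf_eq_right.mpr h]

open Polynomial in
/-- The polynomial vanishing at `q ^ (s - 1 - k)` for `k < r`. -/
def decoderPoly (q s r : ℕ) : ℤ[X] :=
  ∏ k ∈ Finset.range r, (X - C ((q : ℤ) ^ (s - 1 - k)))

lemma decoderPoly_natDegree_lt (q s r : ℕ) : (decoderPoly q s r).natDegree < r + 1 := by
  refine Nat.lt_succ_of_le ((Polynomial.natDegree_prod_le _ _).trans ?_)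
  simp only [Polynomial.natDegree_X_sub_C]
  simp

lemma decoderPoly_eval_pos {q s r : ℕ} (hq : 2 ≤ q) (hrs : r ≤ s) :
    0 < (decoderPoly q s r).eval ((q : ℤ) ^ s) := by
  rw [decoderPoly, Polynomial.eval_prod]
  refine Finset.prod_pos fun k hk => ?_
  have hk := Finset.mem_range.mp hk
  have : (q : ℤ) ^ (s - 1 - k) < (q : ℤ) ^ s :=
    pow_lt_pow_right₀ (by exact_mod_cast hq) (by omega)
  simpa using this

lemma decoderPoly_eval_eq_zero {q s r k : ℕ} (hk : k < r) :
    (decoderPoly q s r).eval ((q : ℤ) ^ (s - 1 - k)) = 0 := by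
  rw [decoderPoly, Polynomial.eval_prod]
  exact Finset.prod_eq_zero (Finset.mem_range.mpr hk) (by simp)

variable {F : Type} [Field F] [Fintype F]

lemma sum_between_const {n r s D : ℕ} {T B : Submodule F (Fin n → F)} (hT : finrank F T = r)
    (hrs : r ≤ s) (hD : gbinom F (finrank F B - r) (s - r) ∣ D) :
    (∑ S : Gr F n s, if T ≤ S.1 ∧ S.1 ≤ B then
      ((D / gbinom F (finrank F B - r) (s - r) : ℕ) : ℤ) else 0) =
      if T ≤ B then (D : ℤ) else 0 := by
  split_ifs with hTB
  · have h := card_between hT rfl hTB hrs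
    rw [Nat.card_eq_fintype_card, Fintype.card_subtype] at h
    rw [← Finset.sum_filter, Finset.sum_const, h, nsmul_eq_mul, ← Nat.cast_mul,
      Nat.mul_div_cancel' hD]
  · exact Finset.sum_eq_zero fun S _ => if_neg fun h => hTB (h.1.trans h.2)

/-- A bounded integral solution of `∂_{s,r} φ = Δ e_R` supported in any `(r + s)`-dimensional
subspace containing `R`. It is a combination of the indicators of `S ≤ ker f`, over linear maps
`f : W → F^m` with `m ≤ r` killing `R`; exactly `q ^ (m * (r + s - dim (R ⊔ T)))` of these kill
`T`, so that `decoderPoly` selects `T = R`. -/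
lemma exists_local_decoder (q s r : ℕ) (hq : 2 ≤ q) (hrs : r ≤ s) :
    ∃ Δ B : ℕ, 0 < Δ ∧ ∀ (F : Type) [Field F] [Fintype F], Fintype.card F = q →
      ∀ (n : ℕ) (R : Gr F n r) (W : Submodule F (Fin n → F)), R.1 ≤ W → finrank F W = r + s →
        ∃ φ : Gr F n s → ℤ, (∀ S, φ S ≠ 0 → S.1 ≤ W) ∧ (∀ S, |φ S| ≤ B) ∧
          ∀ T, bdry F n s r φ T = if T = R then (Δ : ℤ) else 0 := by
  set P := decoderPoly q s r with hP
  set D : ℕ := (2 ^ q ^ (r + s)).factorial with hD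
  have hDpos : 0 < D := Nat.factorial_pos _
  have hPpos := decoderPoly_eval_pos hq hrs
  refine ⟨D * (P.eval ((q : ℤ) ^ s)).toNat,
    ∑ m ∈ Finset.range (r + 1), (P.coeff m).natAbs * (q ^ ((r + s) * m) * D),
    Nat.mul_pos hDpos (Int.lt_toNat.mpr hPpos), ?_⟩
  intro F _ _ hF n R W hRW hW
  let β (m : ℕ) (f : W →ₗ[F] (Fin m → F)) : Submodule F (Fin n → F) :=
    (LinearMap.ker f).map W.subtype
  let c (m : ℕ) (f : W →ₗ[F] (Fin m → F)) : ℕ := gbinom F (finrank F (β m f) - r) (s - r)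
  let φ : Gr F n s → ℤ := fun S => ∑ m ∈ Finset.range (r + 1), P.coeff m *
    ∑ f : W →ₗ[F] (Fin m → F), if R.1 ≤ β m f ∧ S.1 ≤ β m f then ((D / c m f : ℕ) : ℤ) else 0
  have hβW : ∀ m f, β m f ≤ W := fun m f => Submodule.map_subtype_le _ _
  refine ⟨φ, ?_, ?_, ?_⟩
  · intro S hS
    by_contra hSW
    refine hS (Finset.sum_eq_zero fun m _ => ?_)
    rw [Finset.sum_eq_zero fun f _ => if_neg fun h => hSW (h.2.trans (hβW m f)), mul_zero]
  · intro S
    push_cast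
    refine (Finset.abs_sum_le_sum_abs _ _).trans (Finset.sum_le_sum fun m _ => ?_)
    rw [abs_mul]
    refine mul_le_mul_of_nonneg_left ?_ (abs_nonneg _)
    refine (Finset.abs_sum_le_sum_abs _ _).trans ?_
    have hcard : Fintype.card (W →ₗ[F] (Fin m → F)) = q ^ ((r + s) * m) := by
      rw [Module.card_eq_pow_finrank (K := F), Module.finrank_linearMap, hF, hW,
        Module.finrank_fin_fun]
    calc _ ≤ ∑ f : W →ₗ[F] (Fin m → F), (D : ℤ) := by
          refine Finset.sum_le_sum fun f _ => ?_
          split_ifs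
          · rw [Nat.abs_cast]
            exact_mod_cast Nat.div_le_self _ _
          · simp
      _ = _ := by
          rw [Finset.sum_const, Finset.card_univ, hcard, nsmul_eq_mul]
          push_cast
          rfl
  · intro T
    have hkerrank : ∀ m ∈ Finset.range (r + 1), ∀ f, s ≤ finrank F (β m f) := by
      intro m hm f
      have h1 := LinearMap.finrank_range_add_finrank_ker f
      have h2 := Submodule.finrank_le (LinearMap.range f)
      rw [Module.finrank_fin_fun] at h2
      have h3 := Submodule.finrank_map_subtype_eq W (LinearMap.ker f)
      have := Finset.mem_range.mp hm
      simp only [β]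
      omega
    have hdvd : ∀ m ∈ Finset.range (r + 1), ∀ f, c m f ∣ D := by
      intro m hm f
      have h1 := hkerrank m hm f
      have h2 : finrank F (β m f) ≤ r + s := hW ▸ Submodule.finrank_mono (hβW m f)
      refine Nat.dvd_factorial (gbinom_pos (by omega)) ((gbinom_le _ _).trans ?_)
      rw [hF]
      exact Nat.pow_le_pow_right (by norm_num) (Nat.pow_le_pow_right (by omega) (by omega))
    have hexp : bdry F n s r φ T = ∑ m ∈ Finset.range (r + 1), P.coeff m *
        ∑ f : W →ₗ[F] (Fin m → F), if R.1 ≤ β m f ∧ T.1 ≤ β m f then (D : ℤ) else 0 := by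
      rw [bdry_eq_sum]
      have : ∀ S : Gr F n s, (if T.1 ≤ S.1 then φ S else 0) =
          ∑ m ∈ Finset.range (r + 1), P.coeff m * ∑ f : W →ₗ[F] (Fin m → F),
            if R.1 ≤ β m f then
              (if T.1 ≤ S.1 ∧ S.1 ≤ β m f then ((D / c m f : ℕ) : ℤ) else 0) else 0 := by
        intro S
        by_cases h : T.1 ≤ S.1 <;> simp [h, φ, ite_and]
      rw [Finset.sum_congr rfl fun S _ => this S, Finset.sum_comm]
      refine Finset.sum_congr rfl fun m hm => ?_
      rw [← Finset.mul_sum, Finset.sum_comm]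
      congr 1
      refine Finset.sum_congr rfl fun f _ => ?_
      by_cases hR : R.1 ≤ β m f
      · simp only [hR, if_true, true_and]
        exact sum_between_const T.2 hrs (hdvd m hm f)
      · simp [hR]
    by_cases hTW : T.1 ≤ W
    · have hval : bdry F n s r φ T =
          D * P.eval ((q : ℤ) ^ (r + s - finrank F (R.1 ⊔ T.1 : Submodule F (Fin n → F)))) := by
        rw [hexp, Polynomial.eval_eq_sum_range' (decoderPoly_natDegree_lt q s r), Finset.mul_sum]
        refine Finset.sum_congr rfl fun m _ => ?_
        have hcount := card_linearMap_vanishing (W := Fin m → F)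
          ((R.1 ⊔ T.1).comap W.subtype)
        rw [Nat.card_eq_fintype_card, Fintype.card_subtype,
          finrank_comap_subtype (sup_le hRW hTW), hW, hF, Module.finrank_fin_fun] at hcount
        rw [← Finset.sum_filter, Finset.sum_const, nsmul_eq_mul]
        have hfilter : (Finset.univ.filter fun f : W →ₗ[F] (Fin m → F) =>
            R.1 ≤ β m f ∧ T.1 ≤ β m f) = Finset.univ.filter fun f : W →ₗ[F] (Fin m → F) =>
              (R.1 ⊔ T.1).comap W.subtype ≤ LinearMap.ker f := by
          ext f
          simp only [Finset.mem_filter, Finset.mem_univ, true_and, ← sup_le_iff]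
          rw [le_map_subtype_iff]
          exact and_iff_right (sup_le hRW hTW)
        rw [hfilter, hcount, pow_mul]
        push_cast
        ring
      rw [hval]
      split_ifs with hTR
      · subst hTR
        rw [sup_idem, T.2, Nat.add_sub_cancel_left]
        push_cast
        rw [Int.toNat_of_nonneg hPpos.le]
      · have hlt : r < finrank F (R.1 ⊔ T.1 : Submodule F (Fin n → F)) := by
          by_contra hle
          have h1 : R.1 = R.1 ⊔ T.1 :=
            Submodule.eq_of_le_of_finrank_le le_sup_left (by rw [R.2]; omega)
          have h2 : T.1 ≤ R.1 := by rw [h1]; exact le_sup_right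
          exact hTR (Subtype.ext (Submodule.eq_of_le_of_finrank_eq h2 (by rw [R.2, T.2])))
        have hle := Submodule.finrank_sup_add_finrank_inf_eq R.1 T.1
        rw [R.2, T.2] at hle
        set d := finrank F (R.1 ⊔ T.1 : Submodule F (Fin n → F))
        have : r + s - d = s - 1 - (d - r - 1) := by omega
        rw [this, hP, decoderPoly_eval_eq_zero (by omega), mul_zero]
    · have hTR : T ≠ R := fun h => hTW (h ▸ hRW)
      rw [hexp, if_neg hTR]
      refine Finset.sum_eq_zero fun m _ => ?_
      rw [Finset.sum_eq_zero fun f _ => if_neg fun h => hTW (h.2.trans (hβW m f)), mul_zero]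

end Decoder

section Random

/-- A Chernoff bound: independent uniform choices `g i ∈ G i` whose expected number of hits is at
most `μ` for every `k` can be made with all numbers of hits at most `log₂ (#κ * exp μ)`. -/
lemma exists_choice_of_expected_count_le {ι κ α : Type*} [Fintype ι] [Fintype κ]
    (G : ι → Finset α) (hG : ∀ i, (G i).Nonempty) (A : ι → κ → α → Prop) {μ : ℝ}
    (hμ : ∀ k, ∑ i, (((G i).filter (A i k)).card : ℝ) / (G i).card ≤ μ) :
    ∃ g : ι → α, (∀ i, g i ∈ G i) ∧ ∀ k,
      (2 : ℝ) ^ (Finset.univ.filter fun i => A i k (g i)).card ≤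
        Fintype.card κ * Real.exp μ := by
  have hone : ∀ k, ∑ g ∈ Fintype.piFinset G,
      (2 : ℝ) ^ (Finset.univ.filter fun i => A i k (g i)).card ≤
        ∑ g ∈ Fintype.piFinset G, Real.exp μ := by
    intro k
    have h1 : ∀ g : ι → α, (2 : ℝ) ^ (Finset.univ.filter fun i => A i k (g i)).card =
        ∏ i, if A i k (g i) then (2 : ℝ) else 1 := by
      intro g
      rw [← Finset.prod_filter, Finset.prod_const]
    simp only [h1]
    rw [← Finset.prod_univ_sum G fun i a => if A i k a then (2 : ℝ) else 1, Finset.sum_const,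
      Fintype.card_piFinset, nsmul_eq_mul]
    have h2 : ∀ i, (∑ a ∈ G i, if A i k a then (2 : ℝ) else 1) ≤
        (G i).card * Real.exp ((((G i).filter (A i k)).card : ℝ) / (G i).card) := by
      intro i
      have hpos : (0 : ℝ) < (G i).card := by exact_mod_cast (hG i).card_pos
      have h3 : (∑ a ∈ G i, if A i k a then (2 : ℝ) else 1) =
          (G i).card + ((G i).filter (A i k)).card := by
        have : ∀ a, (if A i k a then (2 : ℝ) else 1) = 1 + if A i k a then 1 else 0 := by
          intro a
          split_ifs <;> norm_num
        simp [this, Finset.sum_add_distrib]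
      rw [h3]
      calc ((G i).card : ℝ) + ((G i).filter (A i k)).card
          = (G i).card * ((((G i).filter (A i k)).card : ℝ) / (G i).card + 1) := by
            field_simp
            ring
        _ ≤ _ := mul_le_mul_of_nonneg_left (Real.add_one_le_exp _) hpos.le
    calc ∏ i, (∑ a ∈ G i, if A i k a then (2 : ℝ) else 1)
        ≤ ∏ i, ((G i).card * Real.exp ((((G i).filter (A i k)).card : ℝ) / (G i).card)) := by
          refine Finset.prod_le_prod (fun i _ => Finset.sum_nonneg fun a _ => ?_) fun i _ => h2 i
          split_ifs <;> norm_num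
      _ = (∏ i, ((G i).card : ℝ)) *
            Real.exp (∑ i, (((G i).filter (A i k)).card : ℝ) / (G i).card) := by
          rw [Finset.prod_mul_distrib, Real.exp_sum]
      _ ≤ _ := by
          push_cast
          exact mul_le_mul_of_nonneg_left (Real.exp_le_exp.mpr (hμ k))
            (Finset.prod_nonneg fun i _ => Nat.cast_nonneg _)
  have hsum : ∑ g ∈ Fintype.piFinset G, ∑ k : κ,
      (2 : ℝ) ^ (Finset.univ.filter fun i => A i k (g i)).card ≤
        ∑ g ∈ Fintype.piFinset G, Fintype.card κ * Real.exp μ := by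
    rw [Finset.sum_comm]
    refine (Finset.sum_le_sum fun k _ => hone k).trans (le_of_eq ?_)
    simp only [Finset.sum_const, Finset.card_univ, nsmul_eq_mul]
    ring
  obtain ⟨g, hg, hle⟩ := Finset.exists_le_of_sum_le (Fintype.piFinset_nonempty.mpr hG) hsum
  refine ⟨g, Fintype.mem_piFinset.mp hg, fun k => le_trans ?_ hle⟩
  exact Finset.single_le_sum
    (f := fun k => (2 : ℝ) ^ (Finset.univ.filter fun i => A i k (g i)).card)
    (fun k _ => by positivity) (Finset.mem_univ k)

end Random

section Extensions

lemma finrank_sup_range_eq {F V : Type*} [Field F] [AddCommGroup V] [Module F V]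
    [FiniteDimensional F V] {s : ℕ} {R : Submodule F V} {g : (Fin s → F) →ₗ[F] V}
    (h : ∀ c, g c ∈ R → c = 0) :
    finrank F (R ⊔ LinearMap.range g : Submodule F V) = finrank F R + s := by
  have hker : LinearMap.ker g = ⊥ :=
    (Submodule.eq_bot_iff _).mpr fun c hc => h c (by rw [LinearMap.mem_ker.mp hc]; exact R.zero_mem)
  have hinf : R ⊓ LinearMap.range g = ⊥ := by
    rw [Submodule.eq_bot_iff]
    rintro _ ⟨hx, c, rfl⟩
    rw [h c hx, map_zero]
  have h1 := Submodule.finrank_sup_add_finrank_inf_eq R (LinearMap.range g)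
  have h2 := LinearMap.finrank_range_add_finrank_ker g
  rw [hker, finrank_bot, Module.finrank_fin_fun] at h2
  rw [hinf, finrank_bot] at h1
  omega

lemma exists_independent_mod {F V : Type*} [Field F] [AddCommGroup V] [Module F V]
    [FiniteDimensional F V] (R Q : Submodule F V) {m : ℕ}
    (hm : finrank F (R ⊓ Q : Submodule F V) + m = finrank F Q) :
    ∃ u : Fin m → V, (∀ k, u k ∈ Q) ∧ ∀ a : Fin m → F, ∑ k, a k • u k ∈ R → a = 0 := by
  obtain ⟨Q₂, hQ₂⟩ := Submodule.exists_isCompl (R.comap Q.subtype)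
  have h1 := Submodule.finrank_add_eq_of_isCompl hQ₂
  have h2 : finrank F (R.comap Q.subtype) = finrank F (R ⊓ Q : Submodule F V) := by
    rw [← Submodule.finrank_map_subtype_eq, Submodule.map_comap_subtype, inf_comm]
  let b := finBasisOfFinrankEq F Q₂ (n := m) (by omega)
  refine ⟨fun k => ((b k : Q) : V), fun k => (b k : Q).2, fun a ha => ?_⟩
  have h3 : ((∑ k, a k • b k : Q₂) : Q) ∈ R.comap Q.subtype := by
    simpa using ha
  have h4 : ((∑ k, a k • b k : Q₂) : Q) = 0 :=
    Submodule.disjoint_def.mp hQ₂.disjoint _ h3 (Subtype.coe_prop _)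
  have h5 : (∑ k, a k • b k : Q₂) = 0 := Subtype.ext h4
  funext k
  exact Fintype.linearIndependent_iff.mp b.linearIndependent a h5 k

variable {F : Type} [Field F] [Fintype F]

lemma card_linearMap_prescribed_le {V W : Type*} [AddCommGroup V] [Module F V] [Finite V]
    [AddCommGroup W] [Module F W] [Finite W] {m : ℕ} {c : Fin m → V}
    (hc : LinearIndependent F c) (y : Fin m → W) :
    (Finset.univ.filter fun g : V →ₗ[F] W => ∀ k, g (c k) = y k).card *
        Fintype.card F ^ (m * finrank F W) ≤ Fintype.card F ^ (finrank F V * finrank F W) := by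
  have hA : finrank F (Submodule.span F (Set.range c)) = m := by
    simpa using finrank_span_eq_card hc
  have hmV : m ≤ finrank F V := hA ▸ Submodule.finrank_le _
  have hle : (Finset.univ.filter fun g : V →ₗ[F] W => ∀ k, g (c k) = y k).card ≤
      Fintype.card F ^ ((finrank F V - m) * finrank F W) := by
    rcases (Finset.univ.filter fun g : V →ₗ[F] W => ∀ k, g (c k) = y k).eq_empty_or_nonempty
      with h | ⟨g₀, hg₀⟩
    · simp [h]
    · have h := card_linearMap_vanishing (W := W) (Submodule.span F (Set.range c))
      rw [hA, Nat.card_eq_fintype_card, Fintype.card_subtype] at h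
      rw [← h]
      refine Finset.card_le_card_of_injOn (fun g => g - g₀) ?_ (fun a _ b _ hab => by simpa using hab)
      intro g hg
      simp only [Finset.coe_filter, Finset.mem_univ, true_and, Set.mem_ofPred_eq,
        Finset.mem_filter] at hg hg₀ ⊢
      rw [Submodule.span_le]
      rintro _ ⟨k, rfl⟩
      simp [hg k, hg₀ k]
  calc _ ≤ Fintype.card F ^ ((finrank F V - m) * finrank F W) *
        Fintype.card F ^ (m * finrank F W) := Nat.mul_le_mul_right _ hle
    _ = _ := by rw [← pow_add, ← add_mul, Nat.sub_add_cancel hmV]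

variable {V : Type*} [AddCommGroup V] [Module F V] [Finite V]

/-- The injective linear maps `F^s → V` whose range meets `R` trivially. -/
def extensions (s : ℕ) (R : Submodule F V) : Finset ((Fin s → F) →ₗ[F] V) :=
  Finset.univ.filter fun g => finrank F (R ⊔ LinearMap.range g : Submodule F V) =
    finrank F R + s

lemma card_le_two_mul_card_extensions {s : ℕ} {R : Submodule F V}
    (hV : finrank F R + s + 1 ≤ finrank F V) :
    Fintype.card F ^ (s * finrank F V) ≤ 2 * (extensions s R).card := by
  have := Fintype.ofFinite V
  set q := Fintype.card F with hq
  have hq2 : 2 ≤ q := Fintype.one_lt_card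
  set n := finrank F V
  set bad : Finset ((Fin s → F) →ₗ[F] V) :=
    (Finset.univ.filter fun p : (Fin s → F) × R => p.1 ≠ 0).biUnion
      fun p => Finset.univ.filter fun g => g p.1 = p.2 with hbad
  have hcover : Finset.univ ⊆ extensions s R ∪ bad := by
    intro g _
    by_cases h : ∀ c, g c ∈ R → c = 0
    · exact Finset.mem_union_left _ (Finset.mem_filter.mpr ⟨Finset.mem_univ _,
        finrank_sup_range_eq h⟩)
    · push Not at h
      obtain ⟨c, hc, hc0⟩ := h
      refine Finset.mem_union_right _ (Finset.mem_biUnion.mpr ⟨(c, ⟨g c, hc⟩), ?_, ?_⟩)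
      · simpa using hc0
      · simp
  have hone : ∀ p : (Fin s → F) × R, p.1 ≠ 0 →
      (Finset.univ.filter fun g : (Fin s → F) →ₗ[F] V => g p.1 = p.2).card * q ^ n ≤
        q ^ (s * n) := by
    intro p hp
    have h := card_linearMap_prescribed_le (F := F) (c := fun _ : Fin 1 => p.1)
      (LinearIndependent.of_subsingleton 0 hp) (fun _ => (p.2 : V))
    simpa using h
  have hbadcard : bad.card * q ^ n ≤ q ^ (s + finrank F R) * q ^ (s * n) := by
    calc bad.card * q ^ n
        ≤ (∑ p ∈ Finset.univ.filter fun p : (Fin s → F) × R => p.1 ≠ 0,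
          (Finset.univ.filter fun g : (Fin s → F) →ₗ[F] V => g p.1 = p.2).card) * q ^ n :=
          Nat.mul_le_mul_right _ Finset.card_biUnion_le
      _ ≤ ∑ p ∈ Finset.univ.filter fun p : (Fin s → F) × R => p.1 ≠ 0, q ^ (s * n) := by
          rw [Finset.sum_mul]
          exact Finset.sum_le_sum fun p hp => hone p (Finset.mem_filter.mp hp).2
      _ ≤ ∑ p : (Fin s → F) × R, q ^ (s * n) :=
          Finset.sum_le_sum_of_subset (Finset.filter_subset _ _)
      _ = q ^ (s + finrank F R) * q ^ (s * n) := by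
          rw [Finset.sum_const, Finset.card_univ, Fintype.card_prod, smul_eq_mul,
            Module.card_eq_pow_finrank (K := F) (V := R), Module.card_eq_pow_finrank (K := F),
            Module.finrank_fin_fun, pow_add]
  have htotal : q ^ (s * n) ≤ (extensions s R).card + bad.card := by
    have h := (Finset.card_le_card hcover).trans (Finset.card_union_le _ _)
    rwa [Finset.card_univ, Module.card_eq_pow_finrank (K := F), Module.finrank_linearMap,
      Module.finrank_fin_fun] at h
  have hsmall : 2 * bad.card ≤ q ^ (s * n) := by
    have hpow : 2 * q ^ (s + finrank F R) ≤ q ^ n := by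
      calc 2 * q ^ (s + finrank F R) ≤ q * q ^ (s + finrank F R) := Nat.mul_le_mul_right _ hq2
        _ = q ^ (s + finrank F R + 1) := by ring
        _ ≤ q ^ n := Nat.pow_le_pow_right (by omega) (by omega)
    have hqn : 0 < q ^ n := by positivity
    refine Nat.le_of_mul_le_mul_right (c := q ^ n) ?_ hqn
    calc 2 * bad.card * q ^ n = 2 * (bad.card * q ^ n) := by ring
      _ ≤ 2 * (q ^ (s + finrank F R) * q ^ (s * n)) := Nat.mul_le_mul_left _ hbadcard
      _ = (2 * q ^ (s + finrank F R)) * q ^ (s * n) := by ring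
      _ ≤ q ^ n * q ^ (s * n) := Nat.mul_le_mul_right _ hpow
      _ = _ := by ring
  omega

lemma card_range_sup_covers_le {s m : ℕ} (R Q : Submodule F V)
    (hm : finrank F (R ⊓ Q : Submodule F V) + m = finrank F Q) :
    (Finset.univ.filter fun g : (Fin s → F) →ₗ[F] V => Q ≤ R ⊔ LinearMap.range g).card *
        Fintype.card F ^ (m * finrank F V) ≤
      Fintype.card F ^ ((s + finrank F R) * m) * Fintype.card F ^ (s * finrank F V) := by
  have := Fintype.ofFinite V
  obtain ⟨u, huQ, hu⟩ := exists_independent_mod R Q hm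
  set q := Fintype.card F with hq
  set n := finrank F V
  set good : Finset (Fin m → (Fin s → F) × R) :=
    Finset.univ.filter fun p => LinearIndependent F fun k => (p k).1 with hgood
  have hcover : (Finset.univ.filter fun g : (Fin s → F) →ₗ[F] V => Q ≤ R ⊔ LinearMap.range g) ⊆
      good.biUnion fun p => Finset.univ.filter fun g : (Fin s → F) →ₗ[F] V =>
        ∀ k, g (p k).1 = u k - (p k).2 := by
    intro g hg
    have hg := (Finset.mem_filter.mp hg).2
    have hrep : ∀ k, ∃ p : (Fin s → F) × R, g p.1 = u k - p.2 := by
      intro k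
      obtain ⟨y, hy, z, ⟨c, rfl⟩, hyz⟩ := Submodule.mem_sup.mp (hg (huQ k))
      exact ⟨(c, ⟨y, hy⟩), by simp [← hyz]⟩
    choose p hp using hrep
    refine Finset.mem_biUnion.mpr ⟨p, Finset.mem_filter.mpr ⟨Finset.mem_univ _, ?_⟩, ?_⟩
    · rw [Fintype.linearIndependent_iff]
      intro a ha
      refine congrFun (hu a ?_)
      have h1 : g (∑ k, a k • (p k).1) = 0 := by rw [ha, map_zero]
      simp only [map_sum, map_smul, hp, smul_sub, Finset.sum_sub_distrib] at h1
      rw [sub_eq_zero.mp h1]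
      exact R.sum_mem fun k _ => R.smul_mem _ (p k).2.2
    · simpa using hp
  calc _ ≤ (∑ p ∈ good, (Finset.univ.filter fun g : (Fin s → F) →ₗ[F] V =>
        ∀ k, g (p k).1 = u k - (p k).2).card) * q ^ (m * n) :=
        Nat.mul_le_mul_right _ ((Finset.card_le_card hcover).trans Finset.card_biUnion_le)
    _ ≤ ∑ p ∈ good, q ^ (s * n) := by
        rw [Finset.sum_mul]
        refine Finset.sum_le_sum fun p hp => ?_
        simpa using card_linearMap_prescribed_le (Finset.mem_filter.mp hp).2
          fun k => u k - ((p k).2 : V)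
    _ ≤ ∑ p : Fin m → (Fin s → F) × R, q ^ (s * n) :=
        Finset.sum_le_sum_of_subset (Finset.filter_subset _ _)
    _ = _ := by
        rw [Finset.sum_const, Finset.card_univ, Fintype.card_fun, Fintype.card_prod, smul_eq_mul,
          Module.card_eq_pow_finrank (K := F) (V := R), Module.card_eq_pow_finrank (K := F),
          Module.finrank_fin_fun, Fintype.card_fin, ← pow_add, ← pow_mul]

end Extensions

section Mass

variable {F : Type} [Field F] [Fintype F]

lemma card_gr_le (n k : ℕ) : Fintype.card (Gr F n k) ≤ Fintype.card F ^ (n * k) := by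
  let b : Gr F n k → Fin k → (Fin n → F) := fun R j => (finBasisOfFinrankEq F R.1 R.2 j : Fin n → F)
  have hspan : ∀ R : Gr F n k, Submodule.span F (Set.range (b R)) = R.1 := by
    intro R
    have h := congrArg (Submodule.map R.1.subtype) (finBasisOfFinrankEq F R.1 R.2).span_eq
    rw [Submodule.map_span, ← Set.range_comp, Submodule.map_top, Submodule.range_subtype] at h
    exact h
  have hinj : Function.Injective b := fun R R' h =>
    Subtype.ext (by rw [← hspan R, ← hspan R', h])
  refine (Fintype.card_le_of_injective b hinj).trans (le_of_eq ?_)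
  simp [pow_mul]

/-- Weight bounds on the `r`-dimensional subspaces propagate to smaller subspaces. -/
lemma sum_containing_le {n r : ℕ} {w : Gr F n (r + 1) → ℝ} (hw : ∀ R, 0 ≤ w R) {M : ℝ}
    (hM0 : 0 ≤ M)
    (hM : ∀ Q : Gr F n r, (∑ R, if Q.1 ≤ R.1 then w R else 0) ≤ M) (k : ℕ) :
    ∀ I : Submodule F (Fin n → F), finrank F I + k = r →
      (∑ R, if I ≤ R.1 then w R else 0) ≤ (Fintype.card F : ℝ) ^ (k * n) * M := by
  induction k with
  | zero =>
    intro I hI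
    simpa using hM ⟨I, hI⟩
  | succ k ih =>
    intro I hI
    have hterm : ∀ R : Gr F n (r + 1), (if I ≤ R.1 then w R else 0) ≤
        ∑ x ∈ Finset.univ.filter (fun x : Fin n → F => x ∉ I),
          if I ⊔ Submodule.span F {x} ≤ R.1 then w R else 0 := by
      intro R
      have hnn : ∀ x : Fin n → F, 0 ≤ if I ⊔ Submodule.span F {x} ≤ R.1 then w R else 0 := by
        intro x
        split_ifs
        exacts [hw R, le_rfl]
      split_ifs with hIR
      · obtain ⟨x, hxR, hxI⟩ : ∃ x ∈ R.1, x ∉ I := by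
          by_contra! h
          have := Submodule.finrank_mono h
          have := R.2
          omega
        have hle : I ⊔ Submodule.span F {x} ≤ R.1 :=
          sup_le hIR ((Submodule.span_singleton_le_iff_mem _ _).mpr hxR)
        refine le_trans (by rw [if_pos hle]) (Finset.single_le_sum
          (f := fun x => if I ⊔ Submodule.span F {x} ≤ R.1 then w R else 0)
          (fun x _ => hnn x) (Finset.mem_filter.mpr ⟨Finset.mem_univ x, hxI⟩))
      · exact Finset.sum_nonneg fun x _ => hnn x
    calc (∑ R : Gr F n (r + 1), if I ≤ R.1 then w R else 0)
        ≤ ∑ R : Gr F n (r + 1), ∑ x ∈ Finset.univ.filter (fun x : Fin n → F => x ∉ I),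
          if I ⊔ Submodule.span F {x} ≤ R.1 then w R else 0 := Finset.sum_le_sum fun R _ => hterm R
      _ = ∑ x ∈ Finset.univ.filter (fun x : Fin n → F => x ∉ I), ∑ R : Gr F n (r + 1),
          if I ⊔ Submodule.span F {x} ≤ R.1 then w R else 0 := Finset.sum_comm
      _ ≤ ∑ x ∈ Finset.univ.filter (fun x : Fin n → F => x ∉ I),
          (Fintype.card F : ℝ) ^ (k * n) * M := by
          refine Finset.sum_le_sum fun x hx => ih _ ?_
          rw [Submodule.finrank_sup_span_singleton (Finset.mem_filter.mp hx).2]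
          omega
      _ ≤ (Fintype.card F : ℝ) ^ n * ((Fintype.card F : ℝ) ^ (k * n) * M) := by
          rw [Finset.sum_const, nsmul_eq_mul]
          refine mul_le_mul_of_nonneg_right ?_ (by positivity)
          have := Finset.card_le_univ (Finset.univ.filter fun x : Fin n → F => x ∉ I)
          rw [Fintype.card_fun, Fintype.card_fin] at this
          exact_mod_cast this
      _ = _ := by ring

lemma extension_cover_ratio_le {n r s : ℕ} (hn : r + 1 + s + 1 ≤ n) (R : Gr F n (r + 1))
    (Q : Gr F n r) :
    (((extensions s R.1).filter fun g => Q.1 ≤ R.1 ⊔ LinearMap.range g).card : ℝ) /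
        (extensions s R.1).card ≤
      2 * (Fintype.card F : ℝ) ^ ((s + (r + 1)) * r) /
        (Fintype.card F : ℝ) ^
          ((r - finrank F (R.1 ⊓ Q.1 : Submodule F (Fin n → F))) * n) := by
  set q := Fintype.card F with hq
  have hq2 : 2 ≤ q := Fintype.one_lt_card
  have hi : finrank F (R.1 ⊓ Q.1 : Submodule F (Fin n → F)) ≤ r :=
    (Submodule.finrank_mono inf_le_right).trans_eq Q.2
  set m := r - finrank F (R.1 ⊓ Q.1 : Submodule F (Fin n → F)) with hm
  have h1 := card_le_two_mul_card_extensions (s := s) (R := R.1)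
    (by rw [R.2, Module.finrank_fin_fun]; exact hn)
  have h2 := card_range_sup_covers_le (s := s) (m := m) R.1 Q.1 (by rw [Q.2]; omega)
  rw [Module.finrank_fin_fun, ← hq] at h1 h2
  rw [R.2] at h2
  have h3 : ((extensions s R.1).filter fun g => Q.1 ≤ R.1 ⊔ LinearMap.range g).card ≤
      (Finset.univ.filter fun g : (Fin s → F) →ₗ[F] (Fin n → F) =>
        Q.1 ≤ R.1 ⊔ LinearMap.range g).card :=
    Finset.card_le_card (Finset.filter_subset_filter _ (Finset.subset_univ _))
  have h4 : q ^ ((s + (r + 1)) * m) ≤ q ^ ((s + (r + 1)) * r) :=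
    Nat.pow_le_pow_right (by omega) (Nat.mul_le_mul_left _ (by omega))
  have hpos : 0 < (extensions s R.1).card := by
    have : 0 < q ^ (s * n) := by positivity
    omega
  rw [div_le_div_iff₀ (by exact_mod_cast hpos) (by positivity)]
  have : ((extensions s R.1).filter fun g => Q.1 ≤ R.1 ⊔ LinearMap.range g).card * q ^ (m * n) ≤
      2 * q ^ ((s + (r + 1)) * r) * (extensions s R.1).card := by
    calc _ ≤ _ := Nat.mul_le_mul_right _ h3
      _ ≤ _ := h2
      _ ≤ q ^ ((s + (r + 1)) * r) * (2 * (extensions s R.1).card) := Nat.mul_le_mul h4 h1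
      _ = _ := by ring
  exact_mod_cast this

lemma expected_cover_le {n r s : ℕ} (hn : r + 1 + s + 1 ≤ n) {w : Gr F n (r + 1) → ℝ}
    (hw : ∀ R, 0 ≤ w R) {M : ℝ} (hM0 : 0 ≤ M)
    (hM : ∀ Q : Gr F n r, (∑ R, if Q.1 ≤ R.1 then w R else 0) ≤ M) (Q : Gr F n r) :
    (∑ R, w R * ((((extensions s R.1).filter fun g => Q.1 ≤ R.1 ⊔ LinearMap.range g).card : ℝ) /
        (extensions s R.1).card)) ≤
      2 ^ (Fintype.card F) ^ r * (2 * (Fintype.card F : ℝ) ^ ((s + (r + 1)) * r)) * M := by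
  set q := Fintype.card F with hq
  have hq2 : 2 ≤ q := Fintype.one_lt_card
  set K : ℝ := 2 * (q : ℝ) ^ ((s + (r + 1)) * r) with hK
  have hKpos : 0 ≤ K := by positivity
  rw [← Finset.sum_fiberwise_of_maps_to (s := Finset.univ)
    (t := Finset.univ.filter fun I : Submodule F (Fin n → F) => I ≤ Q.1)
    (g := fun R : Gr F n (r + 1) => R.1 ⊓ Q.1) (fun R _ => by simp)]
  have hcard : (Finset.univ.filter fun I : Submodule F (Fin n → F) => I ≤ Q.1).card ≤
      2 ^ q ^ r := by
    have h := card_submodule_le (F := F) (V := Q.1)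
    rw [Q.2, Nat.card_congr (Submodule.mapIic Q.1).toEquiv] at h
    refine le_trans (le_of_eq ?_) h
    rw [← Fintype.card_subtype, ← Nat.card_eq_fintype_card]
    rfl
  have hone : ∀ I ∈ Finset.univ.filter (fun I : Submodule F (Fin n → F) => I ≤ Q.1),
      (∑ R ∈ Finset.univ.filter (fun R : Gr F n (r + 1) => R.1 ⊓ Q.1 = I), w R *
        ((((extensions s R.1).filter fun g => Q.1 ≤ R.1 ⊔ LinearMap.range g).card : ℝ) /
          (extensions s R.1).card)) ≤ K * M := by
    intro I hI
    have hIr : finrank F I ≤ r := Q.2 ▸ Submodule.finrank_mono (Finset.mem_filter.mp hI).2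
    have hpow : (0 : ℝ) < (q : ℝ) ^ ((r - finrank F I) * n) := by positivity
    calc _ ≤ ∑ R ∈ Finset.univ.filter (fun R : Gr F n (r + 1) => R.1 ⊓ Q.1 = I),
          w R * (K / (q : ℝ) ^ ((r - finrank F I) * n)) := by
          refine Finset.sum_le_sum fun R hR => mul_le_mul_of_nonneg_left ?_ (hw R)
          rw [← (Finset.mem_filter.mp hR).2]
          exact extension_cover_ratio_le hn R Q
      _ ≤ ∑ R ∈ Finset.univ.filter (fun R : Gr F n (r + 1) => I ≤ R.1),
          w R * (K / (q : ℝ) ^ ((r - finrank F I) * n)) := by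
          refine Finset.sum_le_sum_of_subset_of_nonneg (fun R hR => ?_)
            fun R _ _ => mul_nonneg (hw R) (by positivity)
          simp only [Finset.mem_filter, Finset.mem_univ, true_and] at hR ⊢
          exact hR ▸ inf_le_left
      _ = (∑ R : Gr F n (r + 1), if I ≤ R.1 then w R else 0) *
          (K / (q : ℝ) ^ ((r - finrank F I) * n)) := by
          rw [← Finset.sum_mul, Finset.sum_filter]
      _ ≤ ((q : ℝ) ^ ((r - finrank F I) * n) * M) * (K / (q : ℝ) ^ ((r - finrank F I) * n)) :=
          mul_le_mul_of_nonneg_right (sum_containing_le hw hM0 hM _ I (by omega)) (by positivity)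
      _ = K * M := by
          field_simp
  refine (Finset.sum_le_sum hone).trans ?_
  rw [Finset.sum_const, nsmul_eq_mul, mul_assoc ((2 : ℝ) ^ q ^ r)]
  refine mul_le_mul_of_nonneg_right ?_ (mul_nonneg hKpos hM0)
  exact_mod_cast hcard

end Mass

section Boundary

variable {F : Type} [Field F] [Fintype F]

lemma bdry_sum {ι : Type*} [Fintype ι] (n a b : ℕ) (φ : ι → Gr F n a → ℤ) (R : Gr F n b) :
    bdry F n a b (fun S => ∑ i, φ i S) R = ∑ i, bdry F n a b (φ i) R := by
  simp only [bdry_eq_sum]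
  rw [Finset.sum_comm]
  refine Finset.sum_congr rfl fun S _ => ?_
  split_ifs <;> simp

lemma bdry_mul (n a b : ℕ) (c : ℤ) (φ : Gr F n a → ℤ) (R : Gr F n b) :
    bdry F n a b (fun S => c * φ S) R = c * bdry F n a b φ R := by
  simp only [bdry_eq_sum, Finset.mul_sum, mul_ite, mul_zero]

lemma abs_bdry_le {n a b : ℕ} {Φ Ψ : Gr F n a → ℤ} (h : ∀ S, |Φ S| ≤ Ψ S) (R : Gr F n b) :
    |bdry F n a b Φ R| ≤ bdry F n a b Ψ R := by
  simp only [bdry_eq_sum]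
  refine (Finset.abs_sum_le_sum_abs _ _).trans (Finset.sum_le_sum fun S _ => ?_)
  split_ifs
  · exact h S
  · simp

lemma bdry_local {n a b : ℕ} {φ : Gr F n a → ℤ} {W : Submodule F (Fin n → F)} {B : ℤ}
    (h0 : ∀ S, 0 ≤ φ S) (hB : ∀ S, φ S ≤ B) (hB0 : 0 ≤ B) (hW : ∀ S, φ S ≠ 0 → S.1 ≤ W)
    (T : Gr F n b) :
    0 ≤ bdry F n a b φ T ∧
      bdry F n a b φ T ≤ (2 ^ (Fintype.card F) ^ finrank F W : ℕ) * B ∧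
      (bdry F n a b φ T ≠ 0 → T.1 ≤ W) := by
  rw [bdry_eq_sum]
  refine ⟨Finset.sum_nonneg fun S _ => ?_, ?_, fun h => ?_⟩
  · split_ifs
    exacts [h0 S, le_rfl]
  · have hcard : (Finset.univ.filter fun S : Gr F n a => S.1 ≤ W).card ≤
        2 ^ (Fintype.card F) ^ finrank F W := by
      have h := card_submodule_le (F := F) (V := W)
      rw [Nat.card_congr (Submodule.mapIic W).toEquiv] at h
      refine le_trans ?_ h
      rw [← Fintype.card_subtype, ← Nat.card_eq_fintype_card]
      exact Nat.card_le_card_of_injective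
        (fun S : {S : Gr F n a // S.1 ≤ W} => (⟨S.1.1, S.2⟩ : Set.Iic W))
        fun S S' h => Subtype.ext (Subtype.ext (congrArg (fun z => z.1) h))
    calc _ ≤ ∑ S : Gr F n a, if S.1 ≤ W then B else 0 := by
          refine Finset.sum_le_sum fun S _ => ?_
          by_cases hS : S.1 ≤ W
          · rw [if_pos hS]
            split_ifs
            exacts [hB S, hB0]
          · have : φ S = 0 := by
              by_contra h
              exact hS (hW S h)
            simp [this, hS]
      _ = (Finset.univ.filter fun S : Gr F n a => S.1 ≤ W).card * B := by
          rw [← Finset.sum_filter, Finset.sum_const, nsmul_eq_mul]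
      _ ≤ _ := mul_le_mul_of_nonneg_right (by exact_mod_cast hcard) hB0
  · obtain ⟨S, -, hS⟩ := Finset.exists_ne_zero_of_sum_ne_zero h
    have hTS : T.1 ≤ S.1 := by
      by_contra hTS
      exact hS (if_neg hTS)
    rw [if_pos hTS] at hS
    exact hTS.trans (hW S hS)

lemma abs_pPart_le {α : Type} (Φ : α → ℤ) (x : α) : |pPart Φ x| ≤ |Φ x| := by
  unfold pPart
  rcases max_cases (Φ x) 0 with h | h <;> simp [h.1]

lemma abs_nPart_le {α : Type} (Φ : α → ℤ) (x : α) : |nPart Φ x| ≤ |Φ x| := by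
  unfold nPart
  rcases min_cases (Φ x) 0 with h | h <;> simp [h.1]

lemma abs_eq_pPart_sub_nPart {α : Type} (Φ : α → ℤ) (x : α) :
    |Φ x| = pPart Φ x - nPart Φ x := by
  unfold pPart nPart
  rcases abs_cases (Φ x) with h | h <;> omega

lemma isBounded_sum_abs_le {n r : ℕ} {θ : ℝ} {J : Gr F n (r + 1) → ℤ}
    (hJ : IsBounded F n (r + 1) θ J) (Q : Gr F n r) :
    (∑ R : Gr F n (r + 1), if Q.1 ≤ R.1 then (|J R| : ℝ) else 0) ≤
      2 * θ * (Fintype.card F : ℝ) ^ n := by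
  obtain ⟨h1, h2⟩ := hJ Q
  have h3 : (∑ R : Gr F n (r + 1), if Q.1 ≤ R.1 then (|J R| : ℝ) else 0) =
      ((bdry F n (r + 1) r (pPart J) Q : ℤ) : ℝ) - ((bdry F n (r + 1) r (nPart J) Q : ℤ) : ℝ) := by
    rw [bdry_eq_sum, bdry_eq_sum, ← Int.cast_sub, ← Finset.sum_sub_distrib, Int.cast_sum]
    refine Finset.sum_congr rfl fun R _ => ?_
    split_ifs
    · rw [← abs_eq_pPart_sub_nPart, Int.cast_abs]
    · simp
  rw [h3]
  have h4 : ((bdry F n (r + 1) r (pPart J) Q : ℤ) : ℝ) ≤ θ * (Fintype.card F : ℝ) ^ n :=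
    (le_abs_self _).trans h1
  have h5 : -((bdry F n (r + 1) r (nPart J) Q : ℤ) : ℝ) ≤ θ * (Fintype.card F : ℝ) ^ n :=
    (neg_le_abs _).trans h2
  linarith

end Boundary

section Main

lemma exists_dominating_threshold {q : ℕ} (hq : 2 ≤ q) (r : ℕ) :
    ∃ n₀ : ℕ, ∀ n : ℕ, n₀ ≤ n → (n * r : ℕ) * Real.log q ≤ (q : ℝ) ^ ((n : ℝ) / 2) := by
  have hq1 : (1 : ℝ) < q := by exact_mod_cast hq
  have hsqrt : 1 < Real.sqrt q := by
    rw [Real.lt_sqrt zero_le_one]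
    simpa using hq1
  have hlim := (tendsto_pow_const_div_const_pow_of_one_lt 1 hsqrt).mul_const (r * Real.log q)
  rw [zero_mul] at hlim
  obtain ⟨n₀, hn₀⟩ := Filter.eventually_atTop.mp (hlim.eventually_le_const zero_lt_one)
  refine ⟨n₀, fun n hn => ?_⟩
  have h := hn₀ n hn
  have hpos : 0 < Real.sqrt q ^ n := by positivity
  have hpow : (q : ℝ) ^ ((n : ℝ) / 2) = Real.sqrt q ^ n := by
    rw [Real.sqrt_eq_rpow, ← Real.rpow_natCast, ← Real.rpow_mul (by positivity)]
    congr 1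
    ring
  rw [hpow]
  rw [pow_one, div_mul_eq_mul_div, div_le_one hpos] at h
  push_cast
  linarith

lemma le_of_two_pow_le {X N : ℕ} {μ L : ℝ} (hN : 0 < N) (hL : Real.log N ≤ L)
    (h : (2 : ℝ) ^ X ≤ N * Real.exp μ) : (X : ℝ) ≤ 2 * (L + μ) := by
  have h1 := Real.log_le_log (by positivity) h
  rw [Real.log_pow, Real.log_mul (by positivity) (Real.exp_pos _).ne', Real.log_exp] at h1
  have h2 := Real.log_two_gt_d9
  nlinarith [(Nat.cast_nonneg X : (0 : ℝ) ≤ X)]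

variable {F : Type} [Field F] [Fintype F]

lemma bdry_part_bdry_le {ι : Type*} [Fintype ι] {n r s N : ℕ} {B : ℤ} (hB0 : 0 ≤ B)
    {φ : ι → Gr F n s → ℤ} {W : ι → Submodule F (Fin n → F)}
    (hW : ∀ i, finrank F (W i) = N) (hφW : ∀ i S, φ i S ≠ 0 → S.1 ≤ W i)
    (hφB : ∀ i S, |φ i S| ≤ B) {Ψ : Gr F n s → ℤ} (hΨ : ∀ S, |Ψ S| ≤ ∑ i, |φ i S|)
    {p : Gr F n (r + 1) → ℤ} (hp : ∀ T, |p T| ≤ |bdry F n s (r + 1) Ψ T|) (Q : Gr F n r) :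
    |bdry F n (r + 1) r p Q| ≤
      ((2 ^ (Fintype.card F) ^ N : ℕ) * ((2 ^ (Fintype.card F) ^ N : ℕ) * B)) *
        (Finset.univ.filter fun i => Q.1 ≤ W i).card := by
  set L : ℤ := ((2 ^ (Fintype.card F) ^ N : ℕ) : ℤ) with hL
  have hL0 : 0 ≤ L := Nat.cast_nonneg _
  have h1 : ∀ T, |p T| ≤ ∑ i, bdry F n s (r + 1) (fun S => |φ i S|) T := fun T =>
    (hp T).trans ((abs_bdry_le hΨ T).trans_eq (bdry_sum _ _ _ _ T))
  refine (abs_bdry_le h1 Q).trans ?_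
  rw [bdry_sum]
  have hone : ∀ i, bdry F n (r + 1) r (bdry F n s (r + 1) fun S => |φ i S|) Q ≤
      if Q.1 ≤ W i then L * (L * B) else 0 := by
    intro i
    have hin := bdry_local (b := r + 1) (φ := fun S => |φ i S|) (W := W i)
      (fun S => abs_nonneg _) (hφB i) hB0 fun S hS => hφW i S (abs_ne_zero.mp hS)
    rw [hW i] at hin
    obtain ⟨-, h3, h4⟩ := bdry_local (b := r) (W := W i) (fun T => (hin T).1)
      (fun T => (hin T).2.1) (by positivity) (fun T => (hin T).2.2) Q
    rw [hW i] at h3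
    split_ifs with hQ
    · exact h3
    · by_contra hne
      exact hQ (h4 fun h0 => hne h0.le)
  calc _ ≤ ∑ i, if Q.1 ≤ W i then L * (L * B) else 0 := Finset.sum_le_sum fun i _ => hone i
    _ = _ := by
      rw [← Finset.sum_filter, Finset.sum_const, nsmul_eq_mul, mul_comm]

end Main

/-- **Proposition 4.3 (robust local decodability)**: there are `C = C(q,s)` and
`Δ = Δ(q,s,r) ≥ 1` such that for large `n`, if `θ ≥ q^{-n/2}` and `J ∈ Δ·ℤ^{Gr_q(n,r)}` is
`θ`-bounded, then `J = ∂_{s,r}Φ` for some `Φ` with `∂_{s,r}Φ^±` both `Cθ`-bounded. -/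
theorem robust_local_decodability (q s r : ℕ) (hq : IsPrimePow q) (hr : 1 ≤ r) (hrs : r < s) :
    ∃ C : ℝ, ∃ Δ : ℕ, 0 < Δ ∧
      ∀ (F : Type) [Field F] [Fintype F], Fintype.card F = q →
        ∃ n₀ : ℕ, ∀ n : ℕ, n₀ ≤ n →
          ∀ θ : ℝ, (q : ℝ) ^ (-((n : ℝ) / 2)) ≤ θ →
            ∀ J : Gr F n r → ℤ,
              (∀ R : Gr F n r, (Δ : ℤ) ∣ J R) →
              IsBounded F n r θ J →
              ∃ Φ : Gr F n s → ℤ, bdry F n s r Φ = J ∧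
                IsBounded F n r (C * θ) (bdry F n s r (pPart Φ)) ∧
                IsBounded F n r (C * θ) (bdry F n s r (nPart Φ)) := by
  have hq2 : 2 ≤ q := hq.two_le
  obtain ⟨r, rfl⟩ : ∃ r', r = r' + 1 := ⟨r - 1, by omega⟩
  obtain ⟨Δ, B, hΔ, hdec⟩ := exists_local_decoder q s (r + 1) hq2 hrs.le
  set K : ℝ := 2 ^ q ^ r * (2 * (q : ℝ) ^ ((s + (r + 1)) * r)) with hK
  have hK0 : 0 ≤ K := by positivity
  set L : ℕ := 2 ^ q ^ (r + 1 + s) with hL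
  refine ⟨(L * (L * B)) * (2 * (1 + K * 2)), Δ, hΔ, ?_⟩
  intro F _ _ hF
  obtain ⟨n₀, hn₀⟩ := exists_dominating_threshold hq2 r
  refine ⟨max n₀ (r + 1 + s + 1), ?_⟩
  intro n hn θ hθ J hdvd hJ
  have hnn₀ : n₀ ≤ n := (le_max_left _ _).trans hn
  have hns : r + 1 + s + 1 ≤ n := (le_max_right _ _).trans hn
  have hqpos : (0 : ℝ) < q := by positivity
  have hθ0 : 0 ≤ θ := le_trans (by positivity) hθ
  have hθn : (q : ℝ) ^ ((n : ℝ) / 2) ≤ θ * (q : ℝ) ^ n := by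
    calc (q : ℝ) ^ ((n : ℝ) / 2) = (q : ℝ) ^ (-((n : ℝ) / 2)) * (q : ℝ) ^ n := by
          rw [← Real.rpow_natCast, ← Real.rpow_add hqpos]
          congr 1
          ring
      _ ≤ _ := mul_le_mul_of_nonneg_right hθ (by positivity)
  choose a ha using hdvd
  let ι : Type := Σ R : Gr F n (r + 1), Fin (a R).natAbs
  have haJ : ∀ R, ((a R).natAbs : ℝ) ≤ |(J R : ℝ)| := by
    intro R
    rw [ha R, ← Int.cast_abs, abs_mul, Nat.cast_natAbs, Nat.abs_cast]
    exact_mod_cast le_mul_of_one_le_left (abs_nonneg _) (by exact_mod_cast hΔ)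
  have hmass : ∀ Q : Gr F n r, (∑ R : Gr F n (r + 1),
      if Q.1 ≤ R.1 then ((a R).natAbs : ℝ) else 0) ≤ 2 * θ * (q : ℝ) ^ n := by
    intro Q
    rw [← hF]
    refine (Finset.sum_le_sum fun R _ => ?_).trans (isBounded_sum_abs_le hJ Q)
    split_ifs
    exacts [haJ R, le_rfl]
  have hexpected : ∀ Q : Gr F n r, ∑ i : ι, ((((extensions s i.1.1).filter
      fun g => Q.1 ≤ i.1.1 ⊔ LinearMap.range g).card : ℝ) / (extensions s i.1.1).card) ≤
        K * (2 * θ * (q : ℝ) ^ n) := by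
    intro Q
    have h := expected_cover_le (s := s) hns (fun R => Nat.cast_nonneg (a R).natAbs)
      (by positivity) hmass Q
    rw [hF] at h
    rw [Fintype.sum_sigma]
    simpa using h
  have hne : ∀ i : ι, (extensions s i.1.1).Nonempty := by
    intro i
    have h := card_le_two_mul_card_extensions (s := s) (R := i.1.1)
      (by rw [i.1.2, Module.finrank_fin_fun]; exact hns)
    have hpos : 0 < Fintype.card F ^ (s * finrank F (Fin n → F)) := by
      rw [hF]; positivity
    exact Finset.card_pos.mp (by omega)
  obtain ⟨g, hg, hcount⟩ := exists_choice_of_expected_count_le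
    (fun i : ι => extensions s i.1.1) hne
    (fun i (Q : Gr F n r) g => Q.1 ≤ i.1.1 ⊔ LinearMap.range g) hexpected
  let W : ι → Submodule F (Fin n → F) := fun i => i.1.1 ⊔ LinearMap.range (g i)
  have hW : ∀ i, finrank F (W i) = r + 1 + s := by
    intro i
    rw [(Finset.mem_filter.mp (hg i)).2, i.1.2]
  choose φ hφW hφB hφ using fun i : ι => hdec F hF n i.1 (W i) le_sup_left (hW i)
  have hfew : ∀ Q : Gr F n r, ((Finset.univ.filter fun i => Q.1 ≤ W i).card : ℝ) ≤
      2 * (1 + K * 2) * (θ * (q : ℝ) ^ n) := by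
    intro Q
    have hpos : 0 < Fintype.card (Gr F n r) := Fintype.card_pos_iff.mpr ⟨Q⟩
    have hlog : Real.log (Fintype.card (Gr F n r)) ≤ θ * (q : ℝ) ^ n := by
      refine le_trans ?_ ((hn₀ n hnn₀).trans hθn)
      rw [← Real.log_pow]
      refine Real.log_le_log (by exact_mod_cast hpos) ?_
      have h := card_gr_le (F := F) n r
      rw [hF] at h
      exact_mod_cast h
    refine (le_of_two_pow_le hpos hlog (hcount Q)).trans (le_of_eq ?_)
    ring
  let Φ : Gr F n s → ℤ := fun S => ∑ i : ι, (a i.1).sign * φ i S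
  have hΦ : ∀ S, |Φ S| ≤ ∑ i, |φ i S| := by
    intro S
    refine (Finset.abs_sum_le_sum_abs _ _).trans (Finset.sum_le_sum fun i _ => ?_)
    rw [abs_mul]
    refine mul_le_of_le_one_left (abs_nonneg _) ?_
    rcases lt_trichotomy (a i.1) 0 with h | h | h
    · simp [Int.sign_eq_neg_one_of_neg h]
    · simp [h]
    · simp [Int.sign_eq_one_of_pos h]
  have hbound : ∀ Ψ : Gr F n s → ℤ, (∀ S, |Ψ S| ≤ |Φ S|) →
      IsBounded F n (r + 1) ((L * (L * B)) * (2 * (1 + K * 2)) * θ)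
        (bdry F n s (r + 1) Ψ) := by
    intro Ψ hΨ
    have key : ∀ p : Gr F n (r + 1) → ℤ, (∀ T, |p T| ≤ |bdry F n s (r + 1) Ψ T|) →
        ∀ Q : Gr F n r, |((bdry F n (r + 1) r p Q : ℤ) : ℝ)| ≤
          (L * (L * B)) * (2 * (1 + K * 2)) * θ * (Fintype.card F : ℝ) ^ n := by
      intro p hp Q
      have h := bdry_part_bdry_le (B := (B : ℤ)) (Nat.cast_nonneg _) hW hφW hφB
        (fun S => (hΨ S).trans (hΦ S)) hp Q
      rw [hF, ← hL] at h
      have h' : |((bdry F n (r + 1) r p Q : ℤ) : ℝ)| ≤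
          (L * (L * B)) * ((Finset.univ.filter fun i => Q.1 ≤ W i).card : ℝ) := by
        exact_mod_cast h
      refine h'.trans ((mul_le_mul_of_nonneg_left (hfew Q) (by positivity)).trans (le_of_eq ?_))
      rw [hF]
      ring
    exact fun Q => ⟨key _ (abs_pPart_le _) Q, key _ (abs_nPart_le _) Q⟩
  refine ⟨Φ, ?_, hbound _ (abs_pPart_le Φ), hbound _ (abs_nPart_le Φ)⟩
  funext T
  rw [bdry_sum]
  simp only [bdry_mul, hφ]
  rw [Fintype.sum_sigma, Finset.sum_eq_single T]
  · simp only [if_true, Finset.sum_const, Finset.card_univ, Fintype.card_fin, nsmul_eq_mul]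
    rw [ha T, ← mul_assoc, mul_comm _ (a T).sign, Int.sign_mul_natAbs, mul_comm]
  · intro R _ hR
    simp [Ne.symm hR]
  · simp
end
end
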